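/- Let 0 < ε < 1/2, let n be a positive integer, and let c, C, γ > 0. Then there exist constants C₀ > 0 and x₀ (depending only on ε, n, c, C, γ) with the following property. Let x ≥ x₀, let p be a prime with p ≤ (log log x)^{1−ε}, let δ ∈ (0,1], let β ∈ [1/2, 1 − 1/(p·n)], and let A be a set of primes such that for every t ∈ [(log x)^γ, x], | #{ q ∈ A : q ≤ t } − δ·Li(t) + δ·Li(t^β) | ≤ C·t·e^{−c√(log t)}. Then | Σ_{q ∈ A, q ≤ x} 1/q − δ·log log x | ≤ C₀·log log log x. -/

import Mathlib

/-- The logarithmic integral `Li t = ∫_2^t du / log u`. -/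
noncomputable def Li (t : ℝ) : ℝ := ∫ u in (2 : ℝ)..t, 1 / Real.log u

open MeasureTheory Set

lemma Li_hasDerivAt {t : ℝ} (ht : 1 < t) : HasDerivAt Li (1 / Real.log t) t := by
  have hcont : ContinuousOn (fun u : ℝ => 1 / Real.log u) (Ioi 1) := by
    intro u hu
    have hu' : (1:ℝ) < u := hu
    have : Real.log u ≠ 0 := (Real.log_pos hu').ne'
    have h0 : u ≠ 0 := by linarith
    exact (ContinuousAt.div continuousAt_const (Real.continuousAt_log h0) this).continuousWithinAt
  apply intervalIntegral.integral_hasDerivAt_right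
  · apply ContinuousOn.intervalIntegrable
    apply hcont.mono
    intro u hu
    have := hu.1
    have h2 : (1:ℝ) < min 2 t := lt_min (by norm_num) ht
    exact lt_of_lt_of_le h2 hu.1
  · exact hcont.stronglyMeasurableAtFilter isOpen_Ioi t ht
  · exact hcont.continuousAt (Ioi_mem_nhds ht)

lemma Li_bound {t : ℝ} (ht : 2 ≤ t) : 0 ≤ Li t ∧ Li t ≤ 2 * t := by
  have hl2 : (1/2:ℝ) ≤ Real.log 2 := by linarith [Real.log_two_gt_d9]
  have h1 : ∀ u ∈ Icc 2 t, 0 ≤ 1 / Real.log u ∧ 1 / Real.log u ≤ 2 := by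
    intro u hu
    have : Real.log 2 ≤ Real.log u := Real.log_le_log (by norm_num) hu.1
    constructor
    · apply div_nonneg <;> linarith
    · rw [div_le_iff₀ (by linarith)]; linarith
  constructor
  · exact intervalIntegral.integral_nonneg ht fun u hu => (h1 u hu).1
  · have := intervalIntegral.norm_integral_le_of_norm_le_const (a := 2) (b := t)
      (f := fun u => 1 / Real.log u) (C := 2) (by
        intro u hu
        rw [uIoc_of_le ht] at hu
        have := h1 u ⟨hu.1.le, hu.2⟩
        rw [Real.norm_eq_abs, abs_of_nonneg this.1]; exact this.2)
    rw [abs_of_nonneg (by linarith : 0 ≤ t - 2)] at this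
    have h3 := le_trans (le_abs_self _) this
    unfold Li
    linarith

lemma abel_recip (a : ℕ → ℝ) {y x : ℝ} (hy : 1 ≤ y) (hyx : y ≤ x) :
    IntervalIntegrable (fun t => (∑ k ∈ Finset.Icc 0 ⌊t⌋₊, a k) / t ^ 2) volume y x ∧
    ∑ k ∈ Finset.Ioc ⌊y⌋₊ ⌊x⌋₊, (k : ℝ)⁻¹ * a k =
      (∑ k ∈ Finset.Icc 0 ⌊x⌋₊, a k) / x - (∑ k ∈ Finset.Icc 0 ⌊y⌋₊, a k) / y +
       ∫ t in y..x, (∑ k ∈ Finset.Icc 0 ⌊t⌋₊, a k) / t ^ 2 := by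
  have hcont : ContinuousOn (fun t : ℝ => (t^2)⁻¹) (Icc y x) := by
    apply ContinuousOn.inv₀ (by fun_prop)
    intro t ht
    have : 0 < t := by linarith [ht.1]
    positivity
  have hint := integrableOn_mul_sum_Icc a (m := 0) (a := y) (b := x) (by linarith)
    (g := fun t : ℝ => (t^2)⁻¹) hcont.integrableOn_Icc
  have hint2 : IntervalIntegrable (fun t => (∑ k ∈ Finset.Icc 0 ⌊t⌋₊, a k) / t ^ 2) volume y x := by
    rw [intervalIntegrable_iff_integrableOn_Icc_of_le hyx]
    refine hint.congr_fun ?_ measurableSet_Icc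
    intro t _
    simp only; rw [div_eq_inv_mul]
  refine ⟨hint2, ?_⟩
  have hd : deriv (fun t : ℝ => t⁻¹) = fun t => -(t^2)⁻¹ := by
    funext t; simp
  rw [sum_mul_eq_sub_sub_integral_mul a (f := fun t : ℝ => t⁻¹) (by linarith) hyx]
  · rw [hd, intervalIntegral.integral_of_le hyx, sub_eq_add_neg _ (∫ t in Ioc y x, _),
      ← integral_neg]
    congr 1
    · ring
    · congr 1; funext t; ring
  · intro t ht
    exact differentiableAt_inv (by linarith [ht.1])
  · rw [hd]; exact hcont.integrableOn_Icc.neg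

lemma count_bound (a : ℕ → ℝ) (ha : ∀ k, 0 ≤ a k ∧ a k ≤ 1) {t : ℝ} (ht : 1 ≤ t) :
    0 ≤ (∑ k ∈ Finset.Icc 0 ⌊t⌋₊, a k) / t ∧ (∑ k ∈ Finset.Icc 0 ⌊t⌋₊, a k) / t ≤ 2 := by
  constructor
  · exact div_nonneg (Finset.sum_nonneg fun k _ => (ha k).1) (by linarith)
  · rw [div_le_iff₀ (by linarith)]
    have h := Finset.sum_le_card_nsmul (Finset.Icc 0 ⌊t⌋₊) a 1 (fun k _ => (ha k).2)
    simp at h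
    have := Nat.floor_le (by linarith : 0 ≤ t)
    linarith

lemma exp_bound4 {c u : ℝ} (hc : 0 < c) (hu : 0 < u) :
    Real.exp (-c * Real.sqrt u) ≤ 24 / c ^ 4 / u ^ 2 := by
  have hs := Real.sqrt_pos.mpr hu
  have h := Real.pow_div_factorial_le_exp (c * Real.sqrt u) (by positivity) 4
  have h2 : (c * Real.sqrt u)^4 = c^4 * u^2 := by
    rw [mul_pow, show (Real.sqrt u)^4 = ((Real.sqrt u)^2)^2 by ring, Real.sq_sqrt hu.le]
  rw [h2] at h
  norm_num [Nat.factorial] at h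
  rw [neg_mul, Real.exp_neg, div_div]
  rw [inv_le_comm₀ (Real.exp_pos _) (by positivity), inv_div]
  exact h

lemma loglog_hasDerivAt {t : ℝ} (ht : 1 < t) :
    HasDerivAt (fun t => Real.log (Real.log t)) (1 / (t * Real.log t)) t := by
  have := ((Real.hasDerivAt_log (by linarith : t ≠ 0)).log (Real.log_pos ht).ne')
  convert this using 1
  field_simp

lemma J_bound {η y x : ℝ} (hη : 0 < η) (hy : 4 ≤ y) (hyx : y ≤ x) :
    0 ≤ (∫ t in y..x, t ^ (-η) / (t * Real.log t)) ∧
    (∫ t in y..x, t ^ (-η) / (t * Real.log t)) ≤ Real.log ((1 + η) / η) := by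
  have hlog4 : 1 ≤ Real.log 4 := by
    rw [show (4:ℝ) = 2^2 by norm_num, Real.log_pow]; push_cast; linarith [Real.log_two_gt_d9]
  have hlog : ∀ t, y ≤ t → 1 ≤ Real.log t := fun t ht =>
    hlog4.trans (Real.log_le_log (by norm_num) (by linarith))
  have hlx := hlog x hyx
  have hly := hlog y le_rfl
  constructor
  · apply intervalIntegral.integral_nonneg hyx
    intro t ht
    have := hlog t ht.1
    have h0 : 0 < t := by linarith [ht.1]
    positivity
  · have hcont : ContinuousOn (fun t : ℝ => t ^ (-η) / (t * Real.log t)) (uIcc y x) := by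
      rw [uIcc_of_le hyx]
      intro t ht
      have := hlog t ht.1
      have h0 : 0 < t := by linarith [ht.1]
      apply ContinuousAt.continuousWithinAt
      apply ContinuousAt.div
      · exact Real.continuousAt_rpow_const _ _ (Or.inl h0.ne')
      · exact continuousAt_id.mul (Real.continuousAt_log h0.ne')
      · positivity
    have hcont2 : ContinuousOn (fun t : ℝ => 1 / (t * Real.log t * (1 + η * Real.log t))) (uIcc y x) := by
      rw [uIcc_of_le hyx]
      intro t ht
      have := hlog t ht.1
      have h0 : 0 < t := by linarith [ht.1]
      apply ContinuousAt.continuousWithinAt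
      have hl := Real.continuousAt_log h0.ne'
      apply ContinuousAt.div continuousAt_const
      · exact (continuousAt_id.mul hl).mul (continuousAt_const.add (continuousAt_const.mul hl))
      · positivity
    have hmono : (∫ t in y..x, t ^ (-η) / (t * Real.log t)) ≤
        ∫ t in y..x, 1 / (t * Real.log t * (1 + η * Real.log t)) := by
      apply intervalIntegral.integral_mono_on hyx hcont.intervalIntegrable hcont2.intervalIntegrable
      intro t ht
      have := hlog t ht.1
      have h0 : 0 < t := by linarith [ht.1]
      rw [mul_comm (t * Real.log t) (1 + η * Real.log t), ← div_div 1]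
      apply div_le_div_of_nonneg_right _ (by positivity)
      rw [Real.rpow_neg h0.le, one_div]
      apply inv_anti₀ (by positivity)
      rw [Real.rpow_def_of_pos h0]
      linarith [Real.add_one_le_exp (Real.log t * η)]
    refine hmono.trans ?_
    have hftc := intervalIntegral.integral_eq_sub_of_hasDerivAt
      (f := fun t => Real.log (Real.log t) - Real.log (1 + η * Real.log t))
      (f' := fun t => 1 / (t * Real.log t * (1 + η * Real.log t))) (a := y) (b := x)
      (by
        intro t ht
        rw [uIcc_of_le hyx] at ht
        have := hlog t ht.1
        have h0 : 1 < t := by linarith [ht.1]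
        have h1 := loglog_hasDerivAt h0
        have h2 := (((Real.hasDerivAt_log (by linarith : t ≠ 0)).const_mul η).const_add 1).log
          (by positivity)
        refine (h1.sub h2).congr_deriv ?_
        field_simp
        ring) hcont2.intervalIntegrable
    rw [hftc]
    have e1 : Real.log (Real.log x) - Real.log (1 + η * Real.log x) ≤ Real.log (1/η) := by
      rw [← Real.log_div (by positivity) (by positivity)]
      apply Real.log_le_log (by positivity)
      rw [div_le_div_iff₀ (by positivity) (by positivity)]
      linarith
    have e2 : - Real.log (1 + η) ≤ Real.log (Real.log y) - Real.log (1 + η * Real.log y) := by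
      rw [← Real.log_div (by positivity) (by positivity), ← Real.log_inv]
      apply Real.log_le_log (by positivity)
      rw [le_div_iff₀ (by positivity), inv_mul_le_iff₀ (by positivity)]
      nlinarith
    rw [Real.log_div (by positivity) hη.ne']
    rw [one_div, Real.log_inv] at e1
    linarith

lemma E_bound {y x : ℝ} (hy : 4 ≤ y) (hyx : y ≤ x) :
    IntervalIntegrable (fun t => 1 / (t * Real.log t ^ 2)) volume y x ∧
    (∫ t in y..x, 1 / (t * Real.log t ^ 2)) ≤ 1 := by
  have hlog4 : 1 ≤ Real.log 4 := by
    rw [show (4:ℝ) = 2^2 by norm_num, Real.log_pow]; push_cast; linarith [Real.log_two_gt_d9]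
  have hlog : ∀ t, y ≤ t → 1 ≤ Real.log t := fun t ht =>
    hlog4.trans (Real.log_le_log (by norm_num) (by linarith))
  have hcont : ContinuousOn (fun t : ℝ => 1 / (t * Real.log t ^ 2)) (uIcc y x) := by
    rw [uIcc_of_le hyx]
    intro t ht
    have := hlog t ht.1
    have h0 : 0 < t := by linarith [ht.1]
    apply ContinuousAt.continuousWithinAt
    apply ContinuousAt.div continuousAt_const
    · exact continuousAt_id.mul ((Real.continuousAt_log h0.ne').pow 2)
    · positivity
  refine ⟨hcont.intervalIntegrable, ?_⟩
  rw [intervalIntegral.integral_eq_sub_of_hasDerivAt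
      (f := fun t => -(Real.log t)⁻¹) _ hcont.intervalIntegrable]
  · have h1 : 0 ≤ (Real.log x)⁻¹ := inv_nonneg.mpr (by linarith [hlog x hyx])
    have h2 : (Real.log y)⁻¹ ≤ 1 := inv_le_one_of_one_le₀ (hlog y le_rfl)
    linarith
  · intro t ht
    rw [uIcc_of_le hyx] at ht
    have := hlog t ht.1
    have h0 : 0 < t := by linarith [ht.1]
    refine ((Real.hasDerivAt_log h0.ne').inv (by positivity)).neg.congr_deriv ?_
    field_simp
    try ring

lemma main_part {c C : ℝ} (hc : 0 < c) (hC : 0 < C) {δ β y x : ℝ} (hδ0 : 0 < δ) (hδ1 : δ ≤ 1)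
    (hβ : 1 / 2 ≤ β) (hβ1 : β < 1) (hy : 4 ≤ y) (hyx : y ≤ x)
    (a : ℕ → ℝ) (ha : ∀ k, 0 ≤ a k ∧ a k ≤ 1)
    (hN : ∀ t : ℝ, y ≤ t → t ≤ x →
      |(∑ k ∈ Finset.Icc 0 ⌊t⌋₊, a k) - δ * Li t + δ * Li (t ^ β)| ≤
            C * t * Real.exp (-c * Real.sqrt (Real.log t))) :
    |(∑ k ∈ Finset.Ioc ⌊y⌋₊ ⌊x⌋₊, (k : ℝ)⁻¹ * a k) -
      δ * (Real.log (Real.log x) - Real.log (Real.log y))| ≤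
      6 + C * (24 / c ^ 4) + Real.log ((1 + (1 - β)) / (1 - β)) := by
  have hlog4 : 1 ≤ Real.log 4 := by
    rw [show (4:ℝ) = 2^2 by norm_num, Real.log_pow]; push_cast; linarith [Real.log_two_gt_d9]
  have hlog : ∀ t, y ≤ t → 1 ≤ Real.log t := fun t ht =>
    hlog4.trans (Real.log_le_log (by norm_num) (by linarith))
  have hpow : ∀ t, y ≤ t → 2 ≤ t ^ β ∧ t ^ β ≤ t := by
    intro t ht
    constructor
    · calc (2:ℝ) = 4 ^ (1/2:ℝ) := by
            rw [← Real.sqrt_eq_rpow, show (4:ℝ) = 2^2 by norm_num, Real.sqrt_sq (by norm_num)]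
        _ ≤ t ^ (1/2:ℝ) := Real.rpow_le_rpow (by norm_num) (by linarith) (by norm_num)
        _ ≤ t ^ β := Real.rpow_le_rpow_of_exponent_le (by linarith) hβ
    · calc t ^ β ≤ t ^ (1:ℝ) := Real.rpow_le_rpow_of_exponent_le (by linarith) hβ1.le
        _ = t := Real.rpow_one t
  set G : ℝ → ℝ := fun t => Li t - Li (t ^ β) with hG
  have hGd : ∀ t, y ≤ t → HasDerivAt G ((1 - t ^ (-(1 - β))) / Real.log t) t := by
    intro t ht
    have h0 : 0 < t := by linarith
    have hl := hlog t ht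
    have h1 := Li_hasDerivAt (by linarith : 1 < t)
    have h2 := (Li_hasDerivAt (by linarith [(hpow t ht).1] : 1 < t ^ β)).comp t
      (Real.hasDerivAt_rpow_const (p := β) (Or.inl h0.ne'))
    refine (h1.sub h2).congr_deriv ?_
    rw [Real.log_rpow h0, show -(1 - β) = β - 1 by ring]
    have : β ≠ 0 := by linarith
    field_simp
  have hGb : ∀ t, y ≤ t → |G t / t| ≤ 2 := by
    intro t ht
    have h0 : 0 < t := by linarith
    have h1 := Li_bound (by linarith : 2 ≤ t)
    have h2 := Li_bound (hpow t ht).1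
    have h3 := (hpow t ht).2
    rw [abs_div, abs_of_pos h0, div_le_iff₀ h0, abs_le]
    constructor <;> simp only [hG] <;> linarith
  obtain ⟨hNi, hS⟩ := abel_recip a (by linarith : 1 ≤ y) hyx
  obtain ⟨hJ0, hJ1⟩ := J_bound (by linarith : 0 < 1 - β) hy hyx
  obtain ⟨hEi, hE⟩ := E_bound hy hyx
  have hGi : IntervalIntegrable (fun t => G t / t ^ 2) volume y x := by
    apply ContinuousOn.intervalIntegrable
    rw [uIcc_of_le hyx]
    intro t ht
    have h0 : 0 < t := by linarith [ht.1]
    apply ContinuousAt.continuousWithinAt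
    exact (hGd t ht.1).continuousAt.div (continuousAt_id.pow 2) (by positivity)
  have hJi : IntervalIntegrable (fun t => t ^ (-(1 - β)) / (t * Real.log t)) volume y x := by
    apply ContinuousOn.intervalIntegrable
    rw [uIcc_of_le hyx]
    intro t ht
    have := hlog t ht.1
    have h0 : 0 < t := by linarith [ht.1]
    apply ContinuousAt.continuousWithinAt
    apply ContinuousAt.div
    · exact Real.continuousAt_rpow_const _ _ (Or.inl h0.ne')
    · exact continuousAt_id.mul (Real.continuousAt_log h0.ne')
    · positivity
  have hFTC := intervalIntegral.integral_eq_sub_of_hasDerivAt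
      (f := fun t => Real.log (Real.log t) - G t / t)
      (f' := fun t => G t / t ^ 2 + t ^ (-(1 - β)) / (t * Real.log t)) (a := y) (b := x)
      (by
        intro t ht
        rw [uIcc_of_le hyx] at ht
        have := hlog t ht.1
        have h0 : 1 < t := by linarith [ht.1]
        have h0' : 0 < t := by linarith
        refine ((loglog_hasDerivAt h0).sub ((hGd t ht.1).div (hasDerivAt_id t) h0'.ne')).congr_deriv ?_
        simp only [id]
        field_simp
        ring) (hGi.add hJi)
  rw [intervalIntegral.integral_add hGi hJi] at hFTC
  have hdiff : |(∫ t in y..x, (∑ k ∈ Finset.Icc 0 ⌊t⌋₊, a k) / t ^ 2) -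
      δ * ∫ t in y..x, G t / t ^ 2| ≤ C * (24 / c ^ 4) := by
    rw [← intervalIntegral.integral_const_mul, ← intervalIntegral.integral_sub hNi (hGi.const_mul δ)]
    have h := intervalIntegral.norm_integral_le_of_norm_le hyx (μ := volume)
      (f := fun t => (∑ k ∈ Finset.Icc 0 ⌊t⌋₊, a k) / t ^ 2 - δ * (G t / t ^ 2))
      (g := fun t => C * (24 / c ^ 4) * (1 / (t * Real.log t ^ 2)))
      (by
        refine Filter.Eventually.of_forall ?_
        intro t ht
        have hl := hlog t ht.1.le
        have h0 : 0 < t := by linarith [ht.1]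
        have h1 := hN t ht.1.le ht.2
        have h2 := exp_bound4 hc (by linarith : 0 < Real.log t)
        rw [Real.norm_eq_abs]
        have e : (∑ k ∈ Finset.Icc 0 ⌊t⌋₊, a k) / t ^ 2 - δ * (G t / t ^ 2) =
          ((∑ k ∈ Finset.Icc 0 ⌊t⌋₊, a k) - δ * Li t + δ * Li (t ^ β)) / t ^ 2 := by
          simp only [hG]; ring
        rw [e, abs_div, abs_of_pos (by positivity : 0 < t ^ 2), div_le_iff₀ (by positivity)]
        calc _ ≤ _ := h1
          _ ≤ C * t * (24 / c ^ 4 / Real.log t ^ 2) := by gcongr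
          _ = _ := by field_simp) (hEi.const_mul _)
    rw [intervalIntegral.integral_const_mul] at h
    refine h.trans ?_
    have : 0 < C * (24 / c ^ 4) := by positivity
    nlinarith
  have hx2 := count_bound a ha (by linarith : 1 ≤ x)
  have hy2 := count_bound a ha (by linarith : 1 ≤ y)
  have hGx := abs_le.mp (hGb x hyx)
  have hGy := abs_le.mp (hGb y le_rfl)
  rw [hS]
  set I := ∫ t in y..x, (∑ k ∈ Finset.Icc 0 ⌊t⌋₊, a k) / t ^ 2
  set IG := ∫ t in y..x, G t / t ^ 2
  set J := ∫ t in y..x, t ^ (-(1 - β)) / (t * Real.log t)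
  have hIG : δ * (Real.log (Real.log x) - Real.log (Real.log y)) =
    δ * IG + δ * J + δ * (G x / x - G y / y) := by
    have : IG + J = _ := hFTC
    linear_combination (-δ) * this
  rw [hIG]
  have hd := abs_le.mp hdiff
  have hJ2 : 0 ≤ δ * J := by positivity
  have hJ3 : δ * J ≤ J := by nlinarith
  have hg : |δ * (G x / x - G y / y)| ≤ 4 := by
    rw [abs_mul, abs_of_pos hδ0]
    have : |G x / x - G y / y| ≤ 4 := abs_le.mpr ⟨by linarith, by linarith⟩
    nlinarith [abs_nonneg (G x / x - G y / y)]
  have hg := abs_le.mp hg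
  rw [abs_le]
  constructor <;> linarith

open Classical in
lemma small_part : ∃ K K' z : ℝ, 0 ≤ K ∧ 0 ≤ K' ∧ 4 ≤ z ∧ ∀ A : Set ℕ, (∀ q ∈ A, Nat.Prime q) →
    ∀ y, z ≤ y → ∑ k ∈ Finset.Icc 0 ⌊y⌋₊, (k : ℝ)⁻¹ * (if k ∈ A then 1 else 0) ≤
      K * Real.log (Real.log y) + K' := by
  obtain ⟨z₁, hz₁⟩ := Filter.eventually_atTop.mp (Chebyshev.eventually_primeCounting_le one_pos)
  set K := Real.log 4 + 1
  set z := max z₁ 4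
  have hz4 : 4 ≤ z := le_max_right _ _
  have hlog4 : 1 ≤ Real.log 4 := by
    rw [show (4:ℝ) = 2^2 by norm_num, Real.log_pow]; push_cast; linarith [Real.log_two_gt_d9]
  have hK : 0 ≤ K := by simp only [K]; linarith
  refine ⟨K, z + 3, z, hK, by linarith, hz4, ?_⟩
  intro A hA y hy
  set a : ℕ → ℝ := fun k => if k ∈ A then 1 else 0 with haDef
  have ha : ∀ k, 0 ≤ a k ∧ a k ≤ 1 := by
    intro k; simp only [haDef]; split_ifs <;> norm_num
  have hlog : ∀ t, z ≤ t → 1 ≤ Real.log t := fun t ht =>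
    hlog4.trans (Real.log_le_log (by norm_num) (by linarith))
  have hNp : ∀ m : ℕ, ∑ k ∈ Finset.Icc 0 m, a k ≤ Nat.primeCounting m := by
    intro m
    rw [Nat.primeCounting, Nat.primeCounting', Nat.count_eq_card_filter_range]
    simp only [haDef]
    rw [Finset.sum_boole]
    norm_cast
    apply Finset.card_le_card
    intro k hk
    simp only [Finset.mem_filter, Finset.mem_Icc, Finset.mem_range] at hk ⊢
    exact ⟨by omega, hA k hk.2⟩
  have hsplit : ∑ k ∈ Finset.Icc 0 ⌊y⌋₊, (k : ℝ)⁻¹ * a k =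
      ∑ k ∈ Finset.Icc 0 ⌊z⌋₊, (k : ℝ)⁻¹ * a k + ∑ k ∈ Finset.Ioc ⌊z⌋₊ ⌊y⌋₊, (k : ℝ)⁻¹ * a k := by
    have hzy := Nat.floor_le_floor hy
    rw [← Finset.sum_union]
    · congr 1; ext k; simp; omega
    · rw [Finset.disjoint_left]; intro k; simp; omega
  obtain ⟨hNi, hS⟩ := abel_recip a (by linarith : 1 ≤ z) hy
  have hfirst : ∑ k ∈ Finset.Icc 0 ⌊z⌋₊, (k : ℝ)⁻¹ * a k ≤ z + 1 := by
    have h := Finset.sum_le_card_nsmul (Finset.Icc 0 ⌊z⌋₊) (fun k => (k : ℝ)⁻¹ * a k) 1 (by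
      intro k _
      exact mul_le_one₀ (Nat.cast_inv_le_one k) (ha k).1 (ha k).2)
    simp only [Nat.card_Icc, nsmul_eq_mul, mul_one] at h
    push_cast at h
    have := Nat.floor_le (by linarith : 0 ≤ z)
    have e : ((⌊z⌋₊ + 1 - 0 : ℕ) : ℝ) = ⌊z⌋₊ + 1 := by push_cast; ring
    linarith
  have hder : ∀ t ∈ uIcc z y, HasDerivAt (fun t => Real.log (Real.log t)) (1 / (t * Real.log t)) t := by
    intro t ht
    rw [uIcc_of_le hy] at ht
    exact loglog_hasDerivAt (by linarith [ht.1])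
  have hLi : IntervalIntegrable (fun t => 1 / (t * Real.log t)) volume z y := by
    apply ContinuousOn.intervalIntegrable
    rw [uIcc_of_le hy]
    intro t ht
    have := hlog t ht.1
    have h0 : 0 < t := by linarith [ht.1]
    apply ContinuousAt.continuousWithinAt
    apply ContinuousAt.div continuousAt_const
    · exact continuousAt_id.mul (Real.continuousAt_log h0.ne')
    · positivity
  have hint : (∫ t in z..y, (∑ k ∈ Finset.Icc 0 ⌊t⌋₊, a k) / t ^ 2) ≤
      ∫ t in z..y, K * (1 / (t * Real.log t)) := by
    apply intervalIntegral.integral_mono_on hy hNi (hLi.const_mul K)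
    intro t ht
    have hl := hlog t ht.1
    have h0 : 0 < t := by linarith [ht.1]
    have h1 := hz₁ t (le_trans (le_max_left _ _) ht.1)
    have h2 := hNp ⌊t⌋₊
    rw [div_le_iff₀ (by positivity)]
    calc _ ≤ _ := h2
      _ ≤ _ := h1
      _ = _ := by simp only [K]; field_simp
  rw [intervalIntegral.integral_const_mul,
    intervalIntegral.integral_eq_sub_of_hasDerivAt hder hLi] at hint
  have hx2 := count_bound a ha (by linarith : 1 ≤ y)
  have hy2 := count_bound a ha (by linarith : 1 ≤ z)
  have h3 : 0 ≤ K * Real.log (Real.log z) := mul_nonneg hK (Real.log_nonneg (hlog z le_rfl))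
  rw [hsplit, hS]
  linarith

open Classical in
lemma tsum_eq_fin (A : Set ℕ) {x : ℝ} (hx : 0 ≤ x) :
    (∑' q : {q : ℕ // q ∈ A ∧ (q : ℝ) ≤ x}, 1 / ((q : ℕ) : ℝ)) =
      ∑ k ∈ Finset.Icc 0 ⌊x⌋₊, (k : ℝ)⁻¹ * (if k ∈ A then 1 else 0) := by
  have h := tsum_subtype {q : ℕ | q ∈ A ∧ (q : ℝ) ≤ x} (fun q : ℕ => 1 / (q : ℝ))
  refine Eq.trans h ?_
  rw [tsum_eq_sum (s := Finset.Icc 0 ⌊x⌋₊)]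
  · apply Finset.sum_congr rfl
    intro k hk
    have hk' : (k:ℝ) ≤ x := (Nat.le_floor_iff hx).mp (Finset.mem_Icc.mp hk).2
    by_cases hA : k ∈ A <;> simp [Set.indicator, hA, hk']
  · intro k hk
    apply Set.indicator_of_notMem
    rintro ⟨_, h2⟩
    exact hk (Finset.mem_Icc.mpr ⟨Nat.zero_le _, (Nat.le_floor_iff hx).mpr h2⟩)

open Classical in
lemma ncard_eq_fin (A : Set ℕ) {t : ℝ} (ht : 0 ≤ t) :
    (Set.ncard {q : ℕ | q ∈ A ∧ (q : ℝ) ≤ t} : ℝ) =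
      ∑ k ∈ Finset.Icc 0 ⌊t⌋₊, (if k ∈ A then (1:ℝ) else 0) := by
  rw [Finset.sum_boole]
  have : {q : ℕ | q ∈ A ∧ (q : ℝ) ≤ t} = ((Finset.Icc 0 ⌊t⌋₊).filter (· ∈ A) : Finset ℕ) := by
    ext k
    simp [Nat.le_floor_iff ht, and_comm]
  rw [this, Set.ncard_coe_finset]

set_option maxHeartbeats 1000000 in
/-- Let `0 < ε < 1/2`, `n ≥ 1` an integer, and `c, C, γ > 0`.  There exist
`C₀ > 0` and `x₀` (depending only on `ε, n, c, C, γ`) such that: for `x ≥ x₀`,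
a prime `p ≤ (log log x)^{1-ε}`, `δ ∈ (0,1]`, `β ∈ [1/2, 1 - 1/(p n)]`, and a
set `A` of primes with
`|#{q ∈ A : q ≤ t} - δ Li(t) + δ Li(t^β)| ≤ C t e^{-c √(log t)}` for all
`t ∈ [(log x)^γ, x]`, one has
`|Σ_{q ∈ A, q ≤ x} 1/q - δ log log x| ≤ C₀ log log log x`. -/
theorem stmt_15 (ε : ℝ) (hε0 : 0 < ε) (hε1 : ε < 1 / 2) (n : ℕ) (hn : 0 < n)
    (c C γ : ℝ) (hc : 0 < c) (hC : 0 < C) (hγ : 0 < γ) :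
    ∃ C₀ : ℝ, 0 < C₀ ∧ ∃ x₀ : ℝ,
      ∀ x : ℝ, x₀ ≤ x →
      ∀ p : ℕ, p.Prime → (p : ℝ) ≤ Real.log (Real.log x) ^ (1 - ε) →
      ∀ δ : ℝ, 0 < δ → δ ≤ 1 →
      ∀ β : ℝ, 1 / 2 ≤ β → β ≤ 1 - 1 / ((p : ℝ) * n) →
      ∀ A : Set ℕ, (∀ q ∈ A, Nat.Prime q) →
        (∀ t : ℝ, Real.log x ^ γ ≤ t → t ≤ x →
          |(Set.ncard {q : ℕ | q ∈ A ∧ (q : ℝ) ≤ t} : ℝ) - δ * Li t + δ * Li (t ^ β)| ≤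
            C * t * Real.exp (-c * Real.sqrt (Real.log t))) →
        |(∑' q : {q : ℕ // q ∈ A ∧ (q : ℝ) ≤ x}, 1 / ((q : ℕ) : ℝ)) -
            δ * Real.log (Real.log x)| ≤
          C₀ * Real.log (Real.log (Real.log x)) := by
  classical
  obtain ⟨K, K', z, hK, hK', hz, hsmall⟩ := small_part
  have hn1 : (1:ℝ) ≤ n := by exact_mod_cast hn
  have hln : 0 ≤ Real.log (2 * n) := Real.log_nonneg (by linarith)
  set D := C * (24 / c ^ 4) with hD
  have hD0 : 0 < D := by positivity
  set g := Real.log γ with hg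
  refine ⟨K * |g| + K + K' + 6 + D + Real.log (2 * n) + 2 + |g|, by positivity, ?_⟩
  have T1 : Filter.Tendsto (fun x => Real.log x) Filter.atTop Filter.atTop := Real.tendsto_log_atTop
  have T2 := Real.tendsto_log_atTop.comp T1
  have T3 := Real.tendsto_log_atTop.comp T2
  have T4 := (tendsto_rpow_atTop hγ).comp T1
  have T5 : ∀ᶠ x in Filter.atTop, γ * Real.log (Real.log x) ≤ Real.log x := by
    have h := (Real.isLittleO_log_id_atTop.bound (inv_pos.mpr hγ))
    filter_upwards [T1.eventually h, T1.eventually_ge_atTop 1] with x hx h1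
    simp only [Real.norm_eq_abs, id] at hx
    rw [abs_of_nonneg (by linarith : 0 ≤ Real.log x)] at hx
    have := (le_abs_self _).trans hx
    rw [inv_mul_eq_div, le_div_iff₀ hγ] at this
    linarith
  obtain ⟨x₀, hx₀⟩ := Filter.eventually_atTop.mp
    ((T1.eventually_ge_atTop 1).and ((T2.eventually_ge_atTop 1).and ((T3.eventually_ge_atTop 1).and
      ((T4.eventually_ge_atTop z).and (T5.and (Filter.eventually_ge_atTop 1))))))
  refine ⟨x₀, ?_⟩
  intro x hx p hp hpx δ hδ0 hδ1 β hβ0 hβ1 A hA hN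
  obtain ⟨h1, h2, h3, h4, h5, h6⟩ := hx₀ x hx
  simp only [Function.comp] at h2 h3 h4
  set y := Real.log x ^ γ with hy
  set L := Real.log (Real.log x) with hL
  set l := Real.log L with hl
  have hly : Real.log y = γ * L := by rw [hy, Real.log_rpow (by linarith)]
  have hlly : Real.log (Real.log y) = g + l := by
    rw [hly, Real.log_mul hγ.ne' (by linarith)]
  have hyx : y ≤ x := by
    rw [← Real.log_le_log_iff (by linarith) (by linarith), hly]; exact h5
  have hp0 : (0:ℝ) < p := by exact_mod_cast hp.pos
  have hp1 : (1:ℝ) ≤ p := by exact_mod_cast hp.one_lt.le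
  have hpn : 0 < 1 / ((p : ℝ) * n) := by positivity
  have hβlt : β < 1 := by linarith
  have hsm := hsmall A hA y h4
  have hmain := main_part hc hC hδ0 hδ1 hβ0 hβlt (by linarith : 4 ≤ y) hyx
    (fun k => if k ∈ A then 1 else 0) (by intro k; split_ifs <;> norm_num)
    (by
      intro t ht1 ht2
      have := hN t ht1 ht2
      rwa [ncard_eq_fin A (by linarith)] at this)
  have hη : Real.log ((1 + (1 - β)) / (1 - β)) ≤ Real.log (2 * n) + l := by
    have e1 : (1 + (1 - β)) / (1 - β) ≤ 2 * n * p := by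
      rw [div_le_iff₀ (by linarith)]
      have : 1 ≤ (p * n) * (1 - β) := by
        have h : 1 / ((p : ℝ) * n) ≤ 1 - β := by linarith
        rw [div_le_iff₀ (by positivity)] at h
        linarith
      nlinarith
    have e2 : Real.log p ≤ l := by
      have h := Real.log_le_log hp0 hpx
      rw [Real.log_rpow (by linarith)] at h
      nlinarith
    calc _ ≤ Real.log (2 * n * p) := Real.log_le_log (div_pos (by linarith) (by linarith)) e1
      _ = Real.log (2 * n) + Real.log p := Real.log_mul (by positivity) (by positivity)
      _ ≤ _ := by linarith
  rw [tsum_eq_fin A (by linarith)]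
  have hsplit : ∑ k ∈ Finset.Icc 0 ⌊x⌋₊, (k : ℝ)⁻¹ * (if k ∈ A then (1:ℝ) else 0) =
      ∑ k ∈ Finset.Icc 0 ⌊y⌋₊, (k : ℝ)⁻¹ * (if k ∈ A then (1:ℝ) else 0) +
      ∑ k ∈ Finset.Ioc ⌊y⌋₊ ⌊x⌋₊, (k : ℝ)⁻¹ * (if k ∈ A then (1:ℝ) else 0) := by
    have hzy := Nat.floor_le_floor hyx
    rw [← Finset.sum_union]
    · congr 1; ext k; simp; omega
    · rw [Finset.disjoint_left]; intro k; simp; omega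
  have hs0 : 0 ≤ ∑ k ∈ Finset.Icc 0 ⌊y⌋₊, (k : ℝ)⁻¹ * (if k ∈ A then (1:ℝ) else 0) := by
    apply Finset.sum_nonneg; intro k _; positivity
  rw [hsplit]
  rw [hlly] at hsm hmain
  set S1 := ∑ k ∈ Finset.Icc 0 ⌊y⌋₊, (k : ℝ)⁻¹ * (if k ∈ A then (1:ℝ) else 0)
  set S2 := ∑ k ∈ Finset.Ioc ⌊y⌋₊ ⌊x⌋₊, (k : ℝ)⁻¹ * (if k ∈ A then (1:ℝ) else 0)
  have hm := abs_le.mp hmain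
  have hd : |δ * (g + l)| ≤ |g| + l := by
    rw [abs_mul, abs_of_pos hδ0]
    have : |g + l| ≤ |g| + l := (abs_add_le g l).trans (by rw [abs_of_nonneg (by linarith : 0 ≤ l)])
    exact (mul_le_of_le_one_left (abs_nonneg _) hδ1).trans this
  have hd := abs_le.mp hd
  have hKg : K * (g + l) ≤ K * |g| + K * l := by
    linarith [mul_le_mul_of_nonneg_left (le_abs_self g) hK]
  have hA0 := abs_nonneg g
  have hKA : 0 ≤ K * |g| := by positivity
  have hfin : K * |g| + K * l + K' + 6 + D + Real.log (2 * n) + 2 * l + |g| ≤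
      (K * |g| + K + K' + 6 + D + Real.log (2 * n) + 2 + |g|) * l := by
    have : 0 ≤ (K * |g| + K' + 6 + D + Real.log (2 * n) + |g|) * (l - 1) :=
      mul_nonneg (by positivity) (by linarith)
    linarith
  refine le_trans ?_ hfin
  have hKl : 0 ≤ K * l := mul_nonneg hK (by linarith)
  rw [abs_le]
  constructor
  · linarith [hd.1, hd.2, hm.1, hm.2]
  · linarith [hd.1, hd.2, hm.1, hm.2]
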